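/- arXiv:1406.2754 — 2 statements merged into one kernel-verified Lean document; each statement's English description precedes it below -/
import Mathlib

section
/- Let x₀ = 0 and x_n = Σ_{k=1}^n k^{k−2} for n ≥ 1, and let F be the distribution on [0,∞) with tail F̄(x) = n^{−n} for x ∈ [x_{n−1}, x_n), n ≥ 1. Then for every δ > 1, lim_{x→∞} x^δ F̄(x) = ∞; in particular F ∈ 𝒟𝒦₁, and hence F ∈ 𝒟𝒦ᶜ. -/
open MeasureTheory Filter Set Topology

noncomputable section

/-- The (real-valued) tail function of a measure `F` on `ℝ`: `F̄(x) = F((x,∞))`. -/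
def tail (F : Measure ℝ) (x : ℝ) : ℝ := (F (Set.Ioi x)).toReal

/-- A distribution: a Borel probability measure on `[0,∞)` with unbounded support. -/
def IsDistribution (F : Measure ℝ) : Prop :=
  IsProbabilityMeasure F ∧ F (Set.Iio 0) = 0 ∧ ∀ x : ℝ, 0 < F (Set.Ioi x)

/-- The convolution `F*2` of `F` with itself: the law of `X₁ + X₂` for independent `X₁, X₂ ∼ F`. -/
def conv2 (F : Measure ℝ) : Measure ℝ := (F.prod F).map fun p => p.1 + p.2

/-- Heavy-tailed (class 𝒦): all exponential moments are infinite. -/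
def HeavyTailed (F : Measure ℝ) : Prop :=
  ∀ a : ℝ, 0 < a → ∫⁻ y, ENNReal.ofReal (Real.exp (a * y)) ∂F = ⊤

/-- Class 𝒪𝒮 (generalized subexponential): `limsup F̄*²(x)/F̄(x) < ∞`. -/
def MemOS (F : Measure ℝ) : Prop :=
  Filter.atTop.limsup (fun x : ℝ => conv2 F (Set.Ioi x) / F (Set.Ioi x)) < ⊤

/-- Class 𝒟𝒦ᶜ (strongly heavy-tailed): `e^{λx} F̄(x) → ∞` for every `λ > 0`. -/
def StronglyHeavyTailed (F : Measure ℝ) : Prop :=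
  ∀ l : ℝ, 0 < l →
    Filter.Tendsto (fun x : ℝ => Real.exp (l * x) * tail F x) Filter.atTop Filter.atTop

/-- Class 𝒟𝒦₁: `x^δ F̄(x) → ∞` for some `δ > 0`. -/
def MemDK1 (F : Measure ℝ) : Prop :=
  ∃ δ : ℝ, 0 < δ ∧
    Filter.Tendsto (fun x : ℝ => x ^ δ * tail F x) Filter.atTop Filter.atTop

/-- Class ℒ (long-tailed): `F̄(x-t)/F̄(x) → 1` for every `t > 0`. -/
def MemL (F : Measure ℝ) : Prop :=
  ∀ t : ℝ, 0 < t →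
    Filter.Tendsto (fun x : ℝ => tail F (x - t) / tail F x) Filter.atTop (nhds 1)

/-- Class 𝒟 (dominatedly varying): `limsup F̄(x/2)/F̄(x) < ∞`. -/
def MemD (F : Measure ℝ) : Prop :=
  Filter.atTop.limsup (fun x : ℝ => F (Set.Ioi (x / 2)) / F (Set.Ioi x)) < ⊤

/-- Class 𝒪ℒ (generalized long-tailed): `limsup F̄(x-t)/F̄(x) < ∞` for every `t > 0`. -/
def MemOL (F : Measure ℝ) : Prop :=
  ∀ t : ℝ, 0 < t →
    Filter.atTop.limsup (fun x : ℝ => F (Set.Ioi (x - t)) / F (Set.Ioi x)) < ⊤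

/-- Class 𝒮 (subexponential): `F̄*²(x)/F̄(x) → 2`. -/
def MemS (F : Measure ℝ) : Prop :=
  Filter.Tendsto (fun x : ℝ => (conv2 F (Set.Ioi x)).toReal / tail F x)
    Filter.atTop (nhds 2)

/-- Class 𝒥 (principle of a single big jump, for `n = 2`):
`lim_{K→∞} liminf_{x→∞} P(min(X₁,X₂) ≤ K | X₁+X₂ > x) = 1` for independent `X₁, X₂ ∼ F`. -/
def MemJ (F : Measure ℝ) : Prop :=
  Filter.Tendsto (fun K : ℝ => Filter.atTop.liminf (fun x : ℝ =>
      ((F.prod F) {p : ℝ × ℝ | min p.1 p.2 ≤ K ∧ x < p.1 + p.2}).toReal /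
      ((F.prod F) {p : ℝ × ℝ | x < p.1 + p.2}).toReal))
    Filter.atTop (nhds 1)

/-- Weak tail equivalence: `0 < liminf F̄(x)/Ḡ(x) ≤ limsup F̄(x)/Ḡ(x) < ∞`. -/
def WeakTailEquiv (F G : Measure ℝ) : Prop :=
  0 < Filter.atTop.liminf (fun x : ℝ => F (Set.Ioi x) / G (Set.Ioi x)) ∧
  Filter.atTop.limsup (fun x : ℝ => F (Set.Ioi x) / G (Set.Ioi x)) < ⊤

lemma one_le_rpow_self_sub_two (k : ℕ) :
    (1 : ℝ) ≤ ((k : ℝ) + 1) ^ (((k : ℝ) + 1) - 2) := by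
  rcases Nat.eq_zero_or_pos k with rfl | hk
  · simp
  · have h1 : (1 : ℝ) ≤ k := by exact_mod_cast hk
    exact Real.one_le_rpow (by linarith) (by linarith)

lemma exists_index_of_monotone_of_tendsto {x : ℕ → ℝ} (hmono : Monotone x)
    (hlim : Tendsto x atTop atTop) {N : ℕ} {y : ℝ} (hy : x N ≤ y) :
    ∃ n, N ≤ n ∧ x n ≤ y ∧ y < x (n + 1) := by
  classical
  have hex : ∃ m, y < x m := (hlim.eventually_gt_atTop y).exists
  have hspec : y < x (Nat.find hex) := Nat.find_spec hex
  have hlt : N < Nat.find hex := by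
    by_contra! h
    exact absurd (hspec.trans_le (hmono h)) (not_lt.mpr hy)
  obtain ⟨m, hm⟩ : ∃ m, Nat.find hex = m + 1 := ⟨Nat.find hex - 1, by omega⟩
  refine ⟨m, by omega, ?_, hm ▸ hspec⟩
  exact not_lt.mp (Nat.find_min hex (by omega))

lemma add_one_rpow_add_one_le {t : ℝ} (ht : 1 ≤ t) :
    (t + 1) ^ (t + 1) ≤ Real.exp 2 * t ^ (t + 1) := by
  have ht0 : 0 < t := by linarith
  have h1 : t + 1 ≤ Real.exp (1 / t) * t := by
    have h := mul_le_mul_of_nonneg_right (Real.add_one_le_exp (1 / t)) ht0.le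
    have h2 : (1 / t + 1) * t = t + 1 := by field_simp; ring
    linarith
  calc (t + 1) ^ (t + 1) ≤ (Real.exp (1 / t) * t) ^ (t + 1) :=
        Real.rpow_le_rpow (by linarith) h1 (by linarith)
    _ = Real.exp (1 / t * (t + 1)) * t ^ (t + 1) := by
        rw [Real.mul_rpow (Real.exp_pos _).le ht0.le, ← Real.exp_mul]
    _ ≤ Real.exp 2 * t ^ (t + 1) := by
        have h2 : 1 / t * (t + 1) ≤ 2 := by
          rw [one_div_mul_eq_div, div_le_iff₀ ht0]
          linarith
        gcongr

lemma rpow_mul_rpow_neg_lower_bound {t δ : ℝ} (ht : 1 ≤ t)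
    (hexp : 1 ≤ (δ - 1) * t - (2 * δ + 1)) :
    Real.exp (-2) * t ≤ (t ^ (t - 2)) ^ δ * (t + 1) ^ (-(t + 1)) := by
  have ht0 : 0 < t := by linarith
  have hpos : 0 < (t + 1) ^ (t + 1) := Real.rpow_pos_of_pos (by linarith) _
  rw [Real.rpow_neg (by linarith), ← div_eq_mul_inv, le_div_iff₀ hpos]
  calc Real.exp (-2) * t * (t + 1) ^ (t + 1)
      ≤ Real.exp (-2) * t * (Real.exp 2 * t ^ (t + 1)) := by
        gcongr
        exact add_one_rpow_add_one_le ht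
    _ = t ^ (1 : ℝ) * t ^ (t + 1) := by
        rw [Real.exp_neg, Real.rpow_one]
        field_simp
    _ = t ^ (1 + (t + 1)) := (Real.rpow_add ht0 _ _).symm
    _ ≤ t ^ ((t - 2) * δ) := Real.rpow_le_rpow_of_exponent_le ht (by linarith)
    _ = (t ^ (t - 2)) ^ δ := Real.rpow_mul ht0.le _ _

lemma StronglyHeavyTailed.of_memDK1 {F : Measure ℝ} (h : MemDK1 F) :
    StronglyHeavyTailed F := by
  obtain ⟨δ, -, hδ⟩ := h
  intro l hl
  refine tendsto_atTop_mono' _ ?_ hδ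
  filter_upwards [(tendsto_exp_mul_div_rpow_atTop δ l hl).eventually_ge_atTop 1,
    eventually_gt_atTop 0] with y hy hy0
  rw [le_div_iff₀ (Real.rpow_pos_of_pos hy0 δ), one_mul] at hy
  exact mul_le_mul_of_nonneg_right hy ENNReal.toReal_nonneg

/-- for Goldie's example `F` (with `x₀ = 0`, `x_n = ∑_{k=1}^n k^{k-2}` and
`F̄(y) = n^{-n}` on `[x_{n-1}, x_n)`), one has `x^δ F̄(x) → ∞` for every `δ > 1`,
so `F ∈ 𝒟𝒦₁` and hence `F ∈ 𝒟𝒦ᶜ`. -/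
theorem goldie_example_DK1 (x : ℕ → ℝ)
    (hx : ∀ n : ℕ, x n = ∑ k ∈ Finset.range n, ((k : ℝ) + 1) ^ (((k : ℝ) + 1) - 2))
    (F : Measure ℝ) (hF : IsDistribution F)
    (htail : ∀ n : ℕ, ∀ y : ℝ, x n ≤ y → y < x (n + 1) →
      F (Set.Ioi y) = ENNReal.ofReal (((n : ℝ) + 1) ^ (-((n : ℝ) + 1)))) :
    (∀ δ : ℝ, 1 < δ →
        Filter.Tendsto (fun y : ℝ => y ^ δ * tail F y) Filter.atTop Filter.atTop) ∧
    MemDK1 F ∧ StronglyHeavyTailed F := by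
  have hstep (n : ℕ) : x (n + 1) = x n + ((n : ℝ) + 1) ^ (((n : ℝ) + 1) - 2) := by
    rw [hx, hx, Finset.sum_range_succ]
  have hge (n : ℕ) : (n : ℝ) ≤ x n := by
    induction n with
    | zero => simp [hx]
    | succ n ih =>
      rw [hstep]
      push_cast
      linarith [one_le_rpow_self_sub_two n]
  have hmono : Monotone x := monotone_nat_of_le_succ fun n => by
    rw [hstep]
    linarith [one_le_rpow_self_sub_two n]
  have hlim : Tendsto x atTop atTop := tendsto_atTop_mono hge tendsto_natCast_atTop_atTop
  have hlow (n : ℕ) (hn : 1 ≤ n) : (n : ℝ) ^ ((n : ℝ) - 2) ≤ x n := by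
    obtain ⟨m, rfl⟩ : ∃ m, n = m + 1 := ⟨n - 1, by omega⟩
    rw [hstep]
    push_cast
    linarith [hge m, (Nat.cast_nonneg m : (0 : ℝ) ≤ m)]
  have main (δ : ℝ) (hδ : 1 < δ) :
      Tendsto (fun y : ℝ => y ^ δ * tail F y) atTop atTop := by
    refine tendsto_atTop.mpr fun M => ?_
    have hcast : Tendsto (fun n : ℕ => (n : ℝ)) atTop atTop := tendsto_natCast_atTop_atTop
    obtain ⟨N, hN⟩ := eventually_atTop.mp
      (((hcast.const_mul_atTop (Real.exp_pos (-2))).eventually_ge_atTop M).and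
        (((hcast.const_mul_atTop (sub_pos.mpr hδ)).eventually_ge_atTop (1 + (2 * δ + 1))).and
          (eventually_ge_atTop 1)))
    filter_upwards [eventually_ge_atTop (x N)] with y hy
    obtain ⟨n, hn, hny, hyn⟩ := exists_index_of_monotone_of_tendsto hmono hlim hy
    obtain ⟨hM, hexp, hn1⟩ := hN n hn
    have ht : (1 : ℝ) ≤ n := by exact_mod_cast hn1
    have htl : tail F y = ((n : ℝ) + 1) ^ (-((n : ℝ) + 1)) := by
      rw [tail, htail n y hny hyn, ENNReal.toReal_ofReal (by positivity)]
    rw [htl]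
    refine (hM.trans (rpow_mul_rpow_neg_lower_bound (δ := δ) ht (by linarith))).trans ?_
    gcongr
    exact (hlow n hn1).trans hny
  have hDK1 : MemDK1 F := ⟨2, two_pos, main 2 one_lt_two⟩
  exact ⟨main, hDK1, .of_memDK1 hDK1⟩
end
end

section
/- There exists a heavy-tailed distribution F on [0,∞) such that F ∈ 𝒥, F ∉ ℒ, F ∉ 𝒟, F ∈ 𝒟𝒦₁, and F is weakly tail equivalent to some subexponential distribution G ∈ 𝒮. -/
open MeasureTheory Filter Set Topology

noncomputable section

/-- The event `min(X₁, X₂) > K` has small probability relative to the tail at `x`, on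
`X₁ + X₂ > x`, uniformly in large `x`. -/
def NegligibleDoubleJump (F : Measure ℝ) : Prop :=
  ∀ ε : ℝ, 0 < ε → ∃ K : ℝ, ∀ᶠ x in atTop,
    (F.prod F).real {p | K < p.1 ∧ K < p.2 ∧ x < p.1 + p.2} ≤ ε * tail F x

lemma tail_pos {F : Measure ℝ} (hF : IsDistribution F) (x : ℝ) : 0 < tail F x := by
  have := hF.1
  exact ENNReal.toReal_pos (hF.2.2 x).ne' (measure_ne_top _ _)

lemma tail_le_one {F : Measure ℝ} (hF : IsDistribution F) (x : ℝ) : tail F x ≤ 1 := by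
  have := hF.1
  exact measureReal_le_one

lemma measurableSet_lt_sum (x : ℝ) : MeasurableSet {p : ℝ × ℝ | x < p.1 + p.2} :=
  measurableSet_lt measurable_const (measurable_fst.add measurable_snd)

lemma le_prod_lt_sum {F : Measure ℝ} (hF : IsDistribution F) (x : ℝ) :
    tail F x * (2 - tail F x) ≤ (F.prod F).real {p | x < p.1 + p.2} := by
  have := hF.1
  have h1 : F.real (Ici 0) = 1 := by
    rw [← compl_Iio, probReal_compl_eq_one_sub measurableSet_Iio]
    simp [measureReal_def, hF.2.1]
  have hsub : (Ioi x ×ˢ Ici 0) ∪ (Ici 0 ×ˢ Ioi x) ⊆ {p : ℝ × ℝ | x < p.1 + p.2} := by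
    rintro ⟨a, b⟩ (⟨h, h'⟩ | ⟨h, h'⟩) <;> simp only [mem_Ioi, mem_Ici, mem_ofPred_eq] at * <;>
      linarith
  have hint : (Ioi x ×ˢ Ici 0) ∩ (Ici 0 ×ˢ Ioi x) ⊆ (Ioi x ×ˢ Ioi x : Set (ℝ × ℝ)) := by
    rintro ⟨a, b⟩ ⟨⟨h, -⟩, ⟨-, h'⟩⟩
    exact ⟨h, h'⟩
  have e1 := measureReal_union_add_inter (μ := F.prod F) (s := Ioi x ×ˢ Ici 0)
    (t := Ici 0 ×ˢ Ioi x) (measurableSet_Ici.prod measurableSet_Ioi)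
  have e2 := measureReal_mono (μ := F.prod F) hsub
  have e3 := measureReal_mono (μ := F.prod F) hint
  simp only [measureReal_prod_prod, h1] at e1 e2 e3
  change F.real (Ioi x) * (2 - F.real (Ioi x)) ≤ _
  linarith

lemma tail_le_prod_lt_sum {F : Measure ℝ} (hF : IsDistribution F) (x : ℝ) :
    tail F x ≤ (F.prod F).real {p | x < p.1 + p.2} := by
  refine le_trans ?_ (le_prod_lt_sum hF x)
  nlinarith [tail_pos hF x, tail_le_one hF x]

lemma NegligibleDoubleJump.memJ {F : Measure ℝ} (hF : IsDistribution F)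
    (hJ : NegligibleDoubleJump F) : MemJ F := by
  have := hF.1
  rw [MemJ, Metric.tendsto_atTop]
  intro ε hε
  obtain ⟨K₀, hK₀⟩ := hJ (ε / 2) (by positivity)
  refine ⟨K₀, fun K hK => ?_⟩
  set u : ℝ → ℝ := fun x => ((F.prod F) {p : ℝ × ℝ | min p.1 p.2 ≤ K ∧ x < p.1 + p.2}).toReal /
      ((F.prod F) {p : ℝ × ℝ | x < p.1 + p.2}).toReal with hu
  have hle : ∀ x, u x ≤ 1 := fun x => by
    refine div_le_one_of_le₀ (measureReal_mono ?_) measureReal_nonneg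
    exact fun p hp => hp.2
  have hnn : ∀ x, 0 ≤ u x := fun x => by positivity
  have hge : ∀ᶠ x in atTop, 1 - ε / 2 ≤ u x := by
    filter_upwards [hK₀] with x hx
    have hP := tail_le_prod_lt_sum hF x
    have hpos := tail_pos hF x
    rw [hu]
    change _ ≤ (F.prod F).real _ / (F.prod F).real _
    rw [le_div_iff₀ (by linarith)]
    have hsub : {p : ℝ × ℝ | x < p.1 + p.2} ⊆
        {p | min p.1 p.2 ≤ K ∧ x < p.1 + p.2} ∪ {p | K₀ < p.1 ∧ K₀ < p.2 ∧ x < p.1 + p.2} := by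
      intro p hp
      rcases le_or_gt (min p.1 p.2) K with h | h
      · exact Or.inl ⟨h, hp⟩
      · rw [lt_min_iff] at h
        exact Or.inr ⟨hK.trans_lt h.1, hK.trans_lt h.2, hp⟩
    have h1 := (measureReal_mono (μ := F.prod F) hsub).trans (measureReal_union_le _ _)
    nlinarith
  have hb : IsBoundedUnder (· ≥ ·) atTop u := isBoundedUnder_of ⟨0, hnn⟩
  have hc : IsCoboundedUnder (· ≥ ·) atTop u :=
    (isBoundedUnder_of ⟨1, hle⟩ : IsBoundedUnder (· ≤ ·) atTop u).isCoboundedUnder_ge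
  have l1 : 1 - ε / 2 ≤ liminf u atTop := le_liminf_of_le hc hge
  have l2 : liminf u atTop ≤ 1 :=
    liminf_le_of_frequently_le (Eventually.of_forall hle).frequently hb
  rw [Real.dist_eq, abs_lt]
  constructor <;> linarith

lemma NegligibleDoubleJump.memS {G : Measure ℝ} (hG : IsDistribution G)
    (hJ : NegligibleDoubleJump G) (hL : MemL G) : MemS G := by
  have := hG.1
  have hconv : ∀ x, (conv2 G (Ioi x)).toReal = (G.prod G).real {p | x < p.1 + p.2} := fun x => by
    rw [conv2, Measure.map_apply (by fun_prop) measurableSet_Ioi]; rfl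
  have htail : Tendsto (tail G) atTop (𝓝 0) := by
    have h := tendsto_measure_iInter_atTop (μ := G) (s := fun x : ℝ => Ioi x)
      (fun _ => measurableSet_Ioi.nullMeasurableSet) (fun a b h => Ioi_subset_Ioi h)
      ⟨0, measure_ne_top _ _⟩
    have he : (⋂ x : ℝ, Ioi x) = ∅ := by
      ext y; simp only [mem_iInter, mem_Ioi, mem_empty_iff_false, iff_false, not_forall]
      exact ⟨y, lt_irrefl y⟩
    rw [he, measure_empty] at h
    exact (ENNReal.tendsto_toReal ENNReal.zero_ne_top).comp h
  rw [MemS, Metric.tendsto_nhds]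
  intro ε hε
  obtain ⟨K₀, hK₀⟩ := hJ (ε / 2) (by positivity)
  obtain ⟨K, hK, hKpos⟩ : ∃ K, K₀ ≤ K ∧ 0 < K := ⟨max K₀ 1, le_max_left _ _, by simp⟩
  filter_upwards [hK₀, (hL K hKpos).eventually_lt_const (show (1 : ℝ) < 1 + ε / 4 by linarith),
    htail.eventually_lt_const hε] with x hx hxL hx0
  have hpos := tail_pos hG x
  have hlow := le_prod_lt_sum hG x
  rw [hconv, Real.dist_eq, abs_lt]
  rw [div_lt_iff₀ hpos] at hxL
  have hsub : {p : ℝ × ℝ | x < p.1 + p.2} ⊆ (Ioi (x - K) ×ˢ univ ∪ univ ×ˢ Ioi (x - K)) ∪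
      {p | K₀ < p.1 ∧ K₀ < p.2 ∧ x < p.1 + p.2} := by
    intro p hp
    simp only [mem_ofPred_eq] at hp
    rcases le_or_gt p.1 K with h | h
    · refine Or.inl (Or.inr ⟨mem_univ _, ?_⟩)
      simp only [mem_Ioi]; linarith
    rcases le_or_gt p.2 K with h' | h'
    · refine Or.inl (Or.inl ⟨?_, mem_univ _⟩)
      simp only [mem_Ioi]; linarith
    · exact Or.inr ⟨hK.trans_lt h, hK.trans_lt h', hp⟩
  have h1 := (measureReal_mono (μ := G.prod G) hsub).trans (measureReal_union_le _ _)
  have h2 := measureReal_union_le (μ := G.prod G) (Ioi (x - K) ×ˢ univ) (univ ×ˢ Ioi (x - K))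
  simp only [measureReal_prod_prod, probReal_univ, mul_one, one_mul] at h2
  change _ ≤ tail G (x - K) + tail G (x - K) at h2
  rw [lt_sub_iff_add_lt, sub_lt_iff_lt_add, lt_div_iff₀ hpos, div_lt_iff₀ hpos]
  constructor
  · nlinarith
  · nlinarith

lemma MemDK1.heavyTailed {F : Measure ℝ} (h : MemDK1 F) : HeavyTailed F := by
  intro a ha
  obtain ⟨δ, -, hδ⟩ := h
  have h1 : Tendsto (fun x : ℝ => Real.exp (a * x) * tail F x) atTop atTop := by
    refine ((tendsto_exp_mul_div_rpow_atTop δ a ha).atTop_mul_atTop₀ hδ).congr' ?_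
    filter_upwards [eventually_gt_atTop 0] with x hx
    have := Real.rpow_pos_of_pos hx δ
    field_simp
  refine ENNReal.eq_top_of_forall_nnreal_le fun r => ?_
  obtain ⟨x, hx⟩ := (h1.eventually_ge_atTop (r : ℝ)).exists
  have h2 := mul_meas_ge_le_lintegral (μ := F) (f := fun y => ENNReal.ofReal (Real.exp (a * y)))
    (by fun_prop) (ENNReal.ofReal (Real.exp (a * x)))
  refine le_trans ?_ h2
  have hsub : Ioi x ⊆ {y | ENNReal.ofReal (Real.exp (a * x)) ≤ ENNReal.ofReal (Real.exp (a * y))} :=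
    fun y hy => ENNReal.ofReal_le_ofReal (Real.exp_le_exp.2 (by
      have : x < y := hy
      gcongr))
  refine le_trans ?_ (mul_le_mul_right (measure_mono hsub) _)
  calc (r : ENNReal) = ENNReal.ofReal r := by simp
    _ ≤ ENNReal.ofReal (Real.exp (a * x) * tail F x) := ENNReal.ofReal_le_ofReal hx
    _ = ENNReal.ofReal (Real.exp (a * x)) * ENNReal.ofReal (tail F x) :=
        ENNReal.ofReal_mul (Real.exp_pos _).le
    _ ≤ _ := by gcongr; exact ENNReal.ofReal_toReal_le
/-- The atoms of the distribution in `𝒥`: sparse blocks `{a, 2 * a, …, (2 * m + 1) * a}` with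
`a = 4 ^ (m + 1) ^ 2`, the `m`-th block being indexed by `m ^ 2 ≤ n < (m + 1) ^ 2`. -/
def brk (n : ℕ) : ℕ := 4 ^ ((Nat.sqrt n + 1) ^ 2) * (n + 1 - Nat.sqrt n ^ 2)

lemma brk_block {m s : ℕ} (hs : s ≤ 2 * m) :
    brk (m ^ 2 + s) = 4 ^ ((m + 1) ^ 2) * (s + 1) := by
  have h : Nat.sqrt (m ^ 2 + s) = m := by
    rw [pow_two, Nat.sqrt_add_eq]; omega
  rw [brk, h]; congr 1; omega

lemma exists_block (n : ℕ) : ∃ m s, s ≤ 2 * m ∧ n = m ^ 2 + s ∧ Nat.sqrt n = m := by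
  have h1 := Nat.sqrt_le' n
  have h2 := Nat.sqrt_le_add n
  refine ⟨Nat.sqrt n, n - Nat.sqrt n ^ 2, ?_, by omega, rfl⟩
  rw [pow_two]; omega

lemma brk_gap (n : ℕ) : brk n + brk (Nat.sqrt n ^ 2) ≤ brk (n + 1) := by
  obtain ⟨m, s, hs, rfl, hm⟩ := exists_block n
  rw [hm]
  have h0 := brk_block (m := m) (s := 0) (by omega)
  simp only [add_zero] at h0
  rw [h0, brk_block hs]
  rcases hs.lt_or_eq with h | rfl
  · rw [add_assoc, brk_block (by omega)]; apply le_of_eq; ring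
  · have h1 := brk_block (m := m + 1) (s := 0) (by omega)
    have : m ^ 2 + 2 * m + 1 = (m + 1) ^ 2 + 0 := by ring
    rw [this, h1]
    have h2 : 2 * m + 3 < 4 ^ (2 * m + 3) := Nat.lt_pow_self (by norm_num)
    calc _ = 4 ^ ((m + 1) ^ 2) * (2 * m + 2) := by ring
      _ ≤ 4 ^ ((m + 1) ^ 2) * 4 ^ (2 * m + 3) := by gcongr; omega
      _ = _ := by ring

lemma four_pow_le_brk_sq (n : ℕ) : 4 ^ (n + 1) ≤ brk (Nat.sqrt n ^ 2) := by
  obtain ⟨m, s, hs, rfl, hm⟩ := exists_block n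
  have h0 := brk_block (m := m) (s := 0) (by omega)
  simp only [add_zero] at h0
  rw [hm, h0, zero_add, mul_one]
  apply Nat.pow_le_pow_right (by norm_num)
  nlinarith

lemma brk_mono : Monotone brk :=
  monotone_nat_of_le_succ fun n => by have := brk_gap n; omega

lemma four_pow_le_brk (n : ℕ) : 4 ^ (n + 1) ≤ brk n :=
  (four_pow_le_brk_sq n).trans (brk_mono (Nat.sqrt_le' n))

lemma brk_add_le (n : ℕ) : brk n + 2 ^ n * (n + 1) ≤ brk (n + 1) := by
  have h1 := brk_gap n
  have h2 := four_pow_le_brk_sq n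
  have h3 : n + 1 < 2 ^ (n + 1) := Nat.lt_two_pow_self
  have h4 : 2 ^ n * (n + 1) ≤ 4 ^ (n + 1) := by
    calc 2 ^ n * (n + 1) ≤ 2 ^ (n + 1) * 2 ^ (n + 1) := by gcongr; norm_num; omega
      _ = 4 ^ (n + 1) := by rw [← mul_pow]; norm_num
  omega

lemma brk_strictMono : StrictMono brk :=
  strictMono_nat_of_lt_succ fun n => by
    have := brk_add_le n
    have : 0 < 2 ^ n * (n + 1) := by positivity
    omega

/-- A refinement of `brk` with `2 ^ n` points between `brk n` and `brk (n + 1)`, whose spacing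
tends to infinity. -/
def fineBrk (k : ℕ) : ℕ := brk (Nat.log 2 k) + (k - 2 ^ Nat.log 2 k) * (Nat.log 2 k + 1)

lemma brk_le_fineBrk (k : ℕ) : brk (Nat.log 2 k) ≤ fineBrk k := Nat.le_add_right _ _

lemma fineBrk_step {k : ℕ} (hk : k ≠ 0) :
    fineBrk k + (Nat.log 2 k + 1) ≤ fineBrk (k + 1) := by
  have h1 : 2 ^ Nat.log 2 k ≤ k := Nat.pow_log_le_self 2 hk
  have h2 : k < 2 ^ (Nat.log 2 k + 1) := Nat.lt_pow_succ_log_self (by norm_num) k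
  generalize hn : Nat.log 2 k = n at *
  rcases (Nat.succ_le_of_lt h2).lt_or_eq with h | h
  · have h3 : Nat.log 2 (k + 1) = n := by
      rw [Nat.log_eq_iff (by right; simp)]; constructor <;> omega
    rw [fineBrk, fineBrk, h3, hn]
    have : k + 1 - 2 ^ n = k - 2 ^ n + 1 := by omega
    rw [this]; apply le_of_eq; ring
  · have h' : k + 1 = 2 ^ (n + 1) := h
    rw [fineBrk, fineBrk, h', hn, Nat.log_pow (by norm_num), Nat.sub_self]
    have h3 := brk_add_le n
    have h4 : 2 ^ n = k - 2 ^ n + 1 := by rw [pow_succ] at h'; omega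
    rw [h4] at h3
    have h5 : (k - 2 ^ n + 1) * (n + 1) = (k - 2 ^ n) * (n + 1) + (n + 1) := by ring
    omega

lemma fineBrk_mono : Monotone fineBrk :=
  monotone_nat_of_le_succ fun k => by
    rcases eq_or_ne k 0 with rfl | hk
    · simp [fineBrk]
    · have := fineBrk_step hk; omega

lemma fineBrk_le (k : ℕ) : fineBrk k ≤ brk (Nat.log 2 k + 1) := by
  have h2 : k < 2 ^ (Nat.log 2 k + 1) := Nat.lt_pow_succ_log_self (by norm_num) k
  refine le_trans ?_ (brk_add_le _)
  rw [fineBrk]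
  gcongr
  rw [pow_succ] at h2; omega

/-- The law on `ℕ` of `⌊1 / U⌋` for `U` uniform on `(0, 1]`, for which `P(N ≥ n) = 1 / n`. -/
def invUnifLaw : Measure ℕ := (volume.restrict (Ioc (0 : ℝ) 1)).map fun u => ⌊u⁻¹⌋₊

lemma measurable_floor_inv : Measurable fun u : ℝ => ⌊u⁻¹⌋₊ :=
  Nat.measurable_floor.comp measurable_inv

instance : IsProbabilityMeasure invUnifLaw := by
  have : IsProbabilityMeasure (volume.restrict (Ioc (0 : ℝ) 1)) := ⟨by simp⟩
  exact Measure.isProbabilityMeasure_map measurable_floor_inv.aemeasurable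

lemma invUnifLaw_Ici {n : ℕ} (hn : n ≠ 0) : invUnifLaw.real (Ici n) = (n : ℝ)⁻¹ := by
  have hn' : (0 : ℝ) < n := by positivity
  rw [invUnifLaw, map_measureReal_apply measurable_floor_inv measurableSet_Ici,
    measureReal_restrict_apply (measurable_floor_inv measurableSet_Ici)]
  have : (fun u : ℝ => ⌊u⁻¹⌋₊) ⁻¹' Ici n ∩ Ioc 0 1 = Ioc 0 (n : ℝ)⁻¹ := by
    ext u
    simp only [mem_inter_iff, mem_preimage, mem_Ici, mem_Ioc, Nat.le_floor_iff' hn]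
    constructor
    · rintro ⟨h, h0, -⟩
      exact ⟨h0, (le_inv_comm₀ hn' h0).1 h⟩
    · rintro ⟨h0, h⟩
      exact ⟨(le_inv_comm₀ hn' h0).2 h, h0, h.trans (inv_le_one_of_one_le₀ (by
        exact_mod_cast Nat.one_le_iff_ne_zero.2 hn))⟩
  rw [this]
  simp [measureReal_def, hn'.le]

/-- The geometric law on `ℕ`, with `P(N ≥ n) = 2⁻ⁿ`. -/
def geomLaw : Measure ℕ := invUnifLaw.map (Nat.log 2)

instance : IsProbabilityMeasure geomLaw :=
  Measure.isProbabilityMeasure_map (Measurable.of_discrete).aemeasurable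

lemma geomLaw_Ici (n : ℕ) : geomLaw.real (Ici n) = (2 ^ n : ℝ)⁻¹ := by
  rw [geomLaw, map_measureReal_apply Measurable.of_discrete measurableSet_Ici]
  rcases eq_or_ne n 0 with rfl | hn
  · simp
  have : Nat.log 2 ⁻¹' Ici n = Ici (2 ^ n) := by
    ext k
    simp only [mem_preimage, mem_Ici]
    refine ⟨fun h => ?_, Nat.le_log_of_pow_le (by norm_num)⟩
    refine Nat.pow_le_of_le_log ?_ h
    rintro rfl
    simp at h
    exact hn h
  rw [this, invUnifLaw_Ici (by positivity)]
  simp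

/-- The law on `ℝ` of `f N` for `N` of law `μ`. -/
def seqLaw (μ : Measure ℕ) (f : ℕ → ℕ) : Measure ℝ := μ.map fun k => (f k : ℝ)

instance (μ : Measure ℕ) [IsProbabilityMeasure μ] (f : ℕ → ℕ) :
    IsProbabilityMeasure (seqLaw μ f) :=
  Measure.isProbabilityMeasure_map (Measurable.of_discrete).aemeasurable

lemma tail_seqLaw (μ : Measure ℕ) (f : ℕ → ℕ) (x : ℝ) :
    tail (seqLaw μ f) x = μ.real {k | x < f k} :=
  map_measureReal_apply Measurable.of_discrete measurableSet_Ioi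

lemma tail_seqLaw_le {μ : Measure ℕ} [IsFiniteMeasure μ] {f : ℕ → ℕ} (hf : Monotone f) {x : ℝ}
    {k : ℕ} (hk : f k ≤ x) : tail (seqLaw μ f) x ≤ μ.real (Ici (k + 1)) := by
  rw [tail_seqLaw]
  refine measureReal_mono fun j hj => ?_
  by_contra h
  have h1 : f j ≤ f k := hf (by simpa using h)
  have h2 : x < f j := hj
  have h3 : (f j : ℝ) ≤ f k := by exact_mod_cast h1
  linarith

lemma le_tail_seqLaw {μ : Measure ℕ} [IsFiniteMeasure μ] {f : ℕ → ℕ} (hf : Monotone f) {x : ℝ}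
    {k : ℕ} (hk : x < f k) : μ.real (Ici k) ≤ tail (seqLaw μ f) x := by
  rw [tail_seqLaw]
  refine measureReal_mono fun j hj => ?_
  have h1 : (f k : ℝ) ≤ f j := by exact_mod_cast hf hj
  exact hk.trans_le h1

lemma isDistribution_seqLaw {μ : Measure ℕ} [IsProbabilityMeasure μ] {f : ℕ → ℕ}
    (h : ∀ x, 0 < tail (seqLaw μ f) x) : IsDistribution (seqLaw μ f) := by
  refine ⟨inferInstance, ?_, fun x => (ENNReal.toReal_pos_iff.1 (h x)).1⟩
  rw [seqLaw, Measure.map_apply Measurable.of_discrete measurableSet_Iio]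
  have : (fun k : ℕ => (f k : ℝ)) ⁻¹' Iio 0 = ∅ := by
    ext k; simp
  rw [this, measure_empty]

lemma prod_seqLaw (μ : Measure ℕ) [SFinite μ] (f : ℕ → ℕ) {s : Set (ℝ × ℝ)}
    (hs : MeasurableSet s) : ((seqLaw μ f).prod (seqLaw μ f)).real s =
      (μ.prod μ).real {p | ((f p.1 : ℝ), (f p.2 : ℝ)) ∈ s} := by
  rw [seqLaw, Measure.map_prod_map _ _ Measurable.of_discrete Measurable.of_discrete,
    map_measureReal_apply Measurable.of_discrete hs]
  rfl

lemma exists_bracket {f : ℕ → ℕ} (hf : Monotone f) (hub : ∀ n, n ≤ f n) {k : ℕ} {x : ℝ}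
    (hx : f k ≤ x) : ∃ n, k ≤ n ∧ f n ≤ x ∧ x < f (n + 1) := by
  have hex : ∃ n, x < f n := by
    obtain ⟨n, hn⟩ := exists_nat_gt x
    exact ⟨n, hn.trans_le (by exact_mod_cast hub n)⟩
  classical
  have h1 := Nat.find_spec hex
  have hk : k < Nat.find hex := by
    by_contra h
    have h3 : (f (Nat.find hex) : ℝ) ≤ f k := by exact_mod_cast hf (not_lt.1 h)
    linarith
  refine ⟨Nat.find hex - 1, by omega, not_lt.1 (Nat.find_min hex (by omega)), ?_⟩
  rwa [Nat.sub_add_cancel (by omega)]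

lemma eventually_bracket {f : ℕ → ℕ} (hf : Monotone f) (hub : ∀ n, n ≤ f n) (k : ℕ) :
    ∀ᶠ x : ℝ in atTop, ∃ n, k ≤ n ∧ f n ≤ x ∧ x < f (n + 1) := by
  filter_upwards [eventually_ge_atTop (f k : ℝ)] with x hx
  exact exists_bracket hf hub hx

lemma le_brk (n : ℕ) : n ≤ brk n :=
  le_trans ((Nat.lt_pow_self (by norm_num)).le.trans (Nat.pow_le_pow_right (by norm_num)
    (Nat.le_succ n))) (four_pow_le_brk n)

lemma tail_geom_eq {x : ℝ} {n : ℕ} (h1 : brk n ≤ x) (h2 : x < brk (n + 1)) :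
    tail (seqLaw geomLaw brk) x = (2 ^ (n + 1) : ℝ)⁻¹ := by
  rw [← geomLaw_Ici]
  exact le_antisymm (tail_seqLaw_le brk_mono h1) (le_tail_seqLaw brk_mono h2)

lemma le_of_brk_sum {n i j : ℕ} {x : ℝ} (hn : brk (n + 1) ≤ x) (hj : j ≤ n)
    (hx : x < brk i + brk j) : Nat.sqrt n ^ 2 ≤ i := by
  have h1 := brk_gap n
  have h2 := brk_mono hj
  have h3 : brk (n + 1) < brk i + brk j := by exact_mod_cast hn.trans_lt hx
  by_contra h
  have h4 := brk_mono (not_le.1 h).le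
  omega

lemma prod_double_jump_le {μ : Measure ℕ} [IsFiniteMeasure μ]
    (hμ : ∀ n, μ.real (Ici n) ≤ 2 * (2 ^ n : ℝ)⁻¹) {k n : ℕ} (hn : (k + 3) ^ 2 ≤ n) {x : ℝ}
    (hx : brk (n + 1) ≤ x) :
    (μ.prod μ).real {p | (brk k : ℝ) < brk p.1 ∧ (brk k : ℝ) < brk p.2 ∧ x < brk p.1 + brk p.2} ≤
      12 * (2 ^ k : ℝ)⁻¹ * (2 ^ (n + 1) : ℝ)⁻¹ := by
  set r := Nat.sqrt n ^ 2
  have hsub : {p : ℕ × ℕ | (brk k : ℝ) < brk p.1 ∧ (brk k : ℝ) < brk p.2 ∧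
      x < brk p.1 + brk p.2} ⊆
      (Ici (n + 1) ×ˢ Ici k ∪ Ici k ×ˢ Ici (n + 1)) ∪ Ici r ×ˢ Ici r := by
    rintro ⟨i, j⟩ ⟨hi, hj, hij⟩
    simp only [Nat.cast_lt, brk_strictMono.lt_iff_lt] at hi hj hij
    rcases lt_or_ge n i with h | h
    · exact Or.inl (Or.inl ⟨h, hj.le⟩)
    rcases lt_or_ge n j with h' | h'
    · exact Or.inl (Or.inr ⟨hi.le, h'⟩)
    · exact Or.inr ⟨le_of_brk_sum hx h' hij, le_of_brk_sum hx h (by linarith)⟩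
  have hr : n + 1 + k ≤ r + r := by
    obtain ⟨m, s, hs, rfl, hm⟩ := exists_block n
    have h1 : k + 3 ≤ m := by
      rw [← hm, Nat.le_sqrt']; exact hn
    simp only [r, hm]
    nlinarith
  have h1 := (measureReal_mono (μ := μ.prod μ) hsub).trans (measureReal_union_le _ _)
  have h2 := measureReal_union_le (μ := μ.prod μ) (Ici (n + 1) ×ˢ Ici k) (Ici k ×ˢ Ici (n + 1))
  simp only [measureReal_prod_prod] at h1 h2
  have h3 : μ.real (Ici (n + 1)) * μ.real (Ici k) ≤
      2 * (2 ^ (n + 1) : ℝ)⁻¹ * (2 * (2 ^ k : ℝ)⁻¹) := by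
    gcongr <;> apply hμ
  have h4 : μ.real (Ici r) * μ.real (Ici r) ≤ 2 * (2 ^ r : ℝ)⁻¹ * (2 * (2 ^ r : ℝ)⁻¹) := by
    gcongr <;> apply hμ
  have h5 : (2 ^ r : ℝ)⁻¹ * (2 ^ r : ℝ)⁻¹ ≤ (2 ^ (n + 1) : ℝ)⁻¹ * (2 ^ k : ℝ)⁻¹ := by
    rw [← mul_inv, ← mul_inv, ← pow_add, ← pow_add]
    gcongr
    norm_num
  linarith

lemma measurableSet_double_jump (K x : ℝ) :
    MeasurableSet {p : ℝ × ℝ | K < p.1 ∧ K < p.2 ∧ x < p.1 + p.2} :=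
  (measurableSet_lt measurable_const measurable_fst).inter
    ((measurableSet_lt measurable_const measurable_snd).inter (measurableSet_lt_sum x))

lemma negligibleDoubleJump_of_le {F : Measure ℝ} {μ : Measure ℕ} [IsFiniteMeasure μ]
    (hμ : ∀ n, μ.real (Ici n) ≤ 2 * (2 ^ n : ℝ)⁻¹)
    (hF : ∀ x, tail (seqLaw geomLaw brk) x ≤ tail F x)
    (hle : ∀ K x, (F.prod F).real {p | K < p.1 ∧ K < p.2 ∧ x < p.1 + p.2} ≤
      (μ.prod μ).real {p | K < brk p.1 ∧ K < brk p.2 ∧ x < brk p.1 + brk p.2}) :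
    NegligibleDoubleJump F := by
  intro ε hε
  obtain ⟨k, hk⟩ := exists_pow_lt_of_lt_one (show 0 < ε / 24 by positivity)
    (show (2⁻¹ : ℝ) < 1 by norm_num)
  refine ⟨brk k, ?_⟩
  filter_upwards [eventually_bracket brk_mono le_brk ((k + 3) ^ 2 + 1)] with x hx
  obtain ⟨n, hn, h1, h2⟩ := hx
  obtain ⟨n, rfl⟩ : ∃ m, n = m + 1 := ⟨n - 1, by omega⟩
  refine (hle _ _).trans ((prod_double_jump_le hμ (by omega) h1).trans ?_)
  refine le_trans ?_ (mul_le_mul_of_nonneg_left (hF x) hε.le)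
  rw [tail_geom_eq h1 h2, pow_succ 2 (n + 1), mul_inv, ← inv_pow 2 k]
  have : (0 : ℝ) < (2 ^ (n + 1))⁻¹ := by positivity
  nlinarith

lemma tail_fine_eq {x : ℝ} {k : ℕ} (h1 : fineBrk k ≤ x) (h2 : x < fineBrk (k + 1)) :
    tail (seqLaw invUnifLaw fineBrk) x = (k + 1 : ℝ)⁻¹ := by
  have := invUnifLaw_Ici (Nat.succ_ne_zero k)
  push_cast at this
  rw [← this]
  exact le_antisymm (tail_seqLaw_le fineBrk_mono h1) (le_tail_seqLaw fineBrk_mono h2)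

lemma tail_geom_eq_log (x : ℝ) :
    tail (seqLaw geomLaw brk) x = invUnifLaw.real {k | x < brk (Nat.log 2 k)} := by
  rw [tail_seqLaw, geomLaw, map_measureReal_apply Measurable.of_discrete (MeasurableSet.of_discrete)]
  rfl

lemma tail_geom_le_fine (x : ℝ) :
    tail (seqLaw geomLaw brk) x ≤ tail (seqLaw invUnifLaw fineBrk) x := by
  rw [tail_geom_eq_log, tail_seqLaw]
  refine measureReal_mono fun k hk => ?_
  have : (brk (Nat.log 2 k) : ℝ) ≤ fineBrk k := by exact_mod_cast brk_le_fineBrk k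
  exact lt_of_lt_of_le hk this

lemma tail_fine_le {x : ℝ} (hx : brk 0 ≤ x) :
    tail (seqLaw invUnifLaw fineBrk) x ≤ 2 * tail (seqLaw geomLaw brk) x := by
  obtain ⟨n, -, h1, h2⟩ := exists_bracket brk_mono le_brk hx
  rw [tail_geom_eq h1 h2, tail_seqLaw]
  have : {k | x < fineBrk k} ⊆ Nat.log 2 ⁻¹' Ici n := fun k hk => by
    have h3 : (fineBrk k : ℝ) ≤ brk (Nat.log 2 k + 1) := by exact_mod_cast fineBrk_le k
    have h4 : (brk n : ℝ) < brk (Nat.log 2 k + 1) := h1.trans_lt (lt_of_lt_of_le hk h3)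
    rw [Nat.cast_lt, brk_strictMono.lt_iff_lt] at h4
    exact Nat.lt_succ_iff.1 h4
  refine (measureReal_mono this).trans ?_
  rw [← map_measureReal_apply Measurable.of_discrete measurableSet_Ici]
  change geomLaw.real _ ≤ _
  rw [geomLaw_Ici, pow_succ, mul_inv]
  apply le_of_eq; ring

lemma tail_geom_pos (x : ℝ) : 0 < tail (seqLaw geomLaw brk) x := by
  obtain ⟨n, hn⟩ := exists_nat_gt x
  have h : x < brk n := hn.trans_le (by exact_mod_cast le_brk n)
  refine lt_of_lt_of_le ?_ (le_tail_seqLaw brk_mono h)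
  rw [geomLaw_Ici]; positivity

lemma isDistribution_geom : IsDistribution (seqLaw geomLaw brk) :=
  isDistribution_seqLaw tail_geom_pos

lemma isDistribution_fine : IsDistribution (seqLaw invUnifLaw fineBrk) :=
  isDistribution_seqLaw fun x => (tail_geom_pos x).trans_le (tail_geom_le_fine x)

lemma negligibleDoubleJump_geom : NegligibleDoubleJump (seqLaw geomLaw brk) := by
  refine negligibleDoubleJump_of_le (μ := geomLaw) (fun n => ?_) (fun _ => le_rfl) fun K x => ?_
  · rw [geomLaw_Ici]
    have : (0 : ℝ) < (2 ^ n)⁻¹ := by positivity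
    linarith
  · rw [prod_seqLaw _ _ (measurableSet_double_jump K x)]
    rfl

lemma negligibleDoubleJump_fine : NegligibleDoubleJump (seqLaw invUnifLaw fineBrk) := by
  have hmeas : Measurable fun k => Nat.log 2 k + 1 := Measurable.of_discrete
  refine negligibleDoubleJump_of_le (μ := invUnifLaw.map fun k => Nat.log 2 k + 1) (fun n => ?_)
    tail_geom_le_fine fun K x => ?_
  · rcases n with _ | n
    · refine measureReal_le_one.trans (by norm_num)
    · rw [map_measureReal_apply hmeas measurableSet_Ici]
      have : (fun k => Nat.log 2 k + 1) ⁻¹' Ici (n + 1) = Nat.log 2 ⁻¹' Ici n := by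
        ext k; simp
      rw [this, ← map_measureReal_apply Measurable.of_discrete measurableSet_Ici]
      change geomLaw.real _ ≤ _
      rw [geomLaw_Ici, pow_succ, mul_inv]
      apply le_of_eq; ring
  · rw [prod_seqLaw _ _ (measurableSet_double_jump K x), Measure.map_prod_map _ _ hmeas hmeas,
      map_measureReal_apply (hmeas.prodMap hmeas) MeasurableSet.of_discrete]
    refine measureReal_mono fun p hp => ?_
    obtain ⟨h1, h2, h3⟩ := hp
    have e1 : (fineBrk p.1 : ℝ) ≤ brk (Nat.log 2 p.1 + 1) := by exact_mod_cast fineBrk_le _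
    have e2 : (fineBrk p.2 : ℝ) ≤ brk (Nat.log 2 p.2 + 1) := by exact_mod_cast fineBrk_le _
    exact ⟨h1.trans_le e1, h2.trans_le e2, h3.trans_le (add_le_add e1 e2)⟩

lemma le_fineBrk (k : ℕ) : k ≤ fineBrk k := by
  induction k with
  | zero => exact Nat.zero_le _
  | succ k ih =>
    rcases eq_or_ne k 0 with rfl | hk
    · have := four_pow_le_brk 0
      have h1 : fineBrk 1 = brk 0 := by simp [fineBrk]
      rw [zero_add, h1]; omega
    · have := fineBrk_step hk; omega

lemma memL_fine : MemL (seqLaw invUnifLaw fineBrk) := by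
  intro t ht
  rw [Metric.tendsto_nhds]
  intro ε hε
  obtain ⟨N, hN⟩ := exists_nat_gt ε⁻¹
  obtain ⟨T, hT⟩ := exists_nat_gt t
  filter_upwards [eventually_bracket fineBrk_mono le_fineBrk (N + 2 ^ T + 1)] with x hx
  obtain ⟨k, hk, h1, h2⟩ := hx
  have hT0 : 0 < 2 ^ T := by positivity
  obtain ⟨k, rfl⟩ : ∃ m, k = m + 1 := ⟨k - 1, by omega⟩
  have hk0 : k ≠ 0 := by omega
  have hstep := fineBrk_step hk0
  have hT' : T ≤ Nat.log 2 k := Nat.le_log_of_pow_le (by norm_num) (by omega)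
  have hstep' : (fineBrk k : ℝ) + T ≤ fineBrk (k + 1) := by
    exact_mod_cast (by omega : fineBrk k + T ≤ fineBrk (k + 1))
  have hup := tail_seqLaw_le (μ := invUnifLaw) fineBrk_mono (x := x - t) (k := k) (by linarith)
  rw [invUnifLaw_Ici (Nat.succ_ne_zero k)] at hup
  have hmono : tail (seqLaw invUnifLaw fineBrk) x ≤ tail (seqLaw invUnifLaw fineBrk) (x - t) :=
    measureReal_mono (Ioi_subset_Ioi (by linarith))
  have hpos := tail_pos isDistribution_fine x
  have hε' : 1 < ε * (k + 1) := by
    have h3 : (N : ℝ) ≤ k := by exact_mod_cast (by omega : N ≤ k)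
    have : ε⁻¹ < k + 1 := by linarith
    rwa [inv_lt_iff_one_lt_mul₀' hε] at this
  have hkey : tail (seqLaw invUnifLaw fineBrk) (x - t) <
      (1 + ε) * tail (seqLaw invUnifLaw fineBrk) x := by
    refine hup.trans_lt ?_
    rw [tail_fine_eq h1 h2]
    push_cast
    rw [← div_eq_mul_inv, inv_lt_comm₀ (by positivity) (by positivity), inv_div,
      div_lt_iff₀ (by positivity)]
    nlinarith
  rw [Real.dist_eq, abs_lt, lt_sub_iff_add_lt, sub_lt_iff_lt_add, lt_div_iff₀ hpos,
    div_lt_iff₀ hpos]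
  constructor <;> nlinarith

lemma memDK1_geom : MemDK1 (seqLaw geomLaw brk) := by
  refine ⟨1, one_pos, tendsto_atTop.2 fun M => ?_⟩
  obtain ⟨N, hN⟩ := exists_nat_gt M
  filter_upwards [eventually_bracket brk_mono le_brk N] with x hx
  obtain ⟨n, hn, h1, h2⟩ := hx
  rw [tail_geom_eq h1 h2, Real.rpow_one, ← div_eq_mul_inv, le_div_iff₀ (by positivity)]
  have h3 : (4 ^ (n + 1) : ℝ) ≤ brk n := by exact_mod_cast four_pow_le_brk n
  have h4 : (n + 1 : ℝ) < 2 ^ (n + 1) := by exact_mod_cast Nat.lt_two_pow_self (n := n + 1)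
  have h5 : (N : ℝ) ≤ n := by exact_mod_cast hn
  calc M * 2 ^ (n + 1) ≤ 2 ^ (n + 1) * 2 ^ (n + 1) := by gcongr; linarith
    _ = 4 ^ (n + 1) := by rw [← mul_pow]; norm_num
    _ ≤ x := h3.trans h1

lemma tail_geom_brk (n : ℕ) : tail (seqLaw geomLaw brk) (brk n) = (2 ^ (n + 1) : ℝ)⁻¹ :=
  tail_geom_eq le_rfl (by exact_mod_cast brk_strictMono (Nat.lt_succ_self n))

lemma tendsto_brk : Tendsto (fun n => (brk n : ℝ)) atTop atTop :=
  tendsto_natCast_atTop_atTop.comp brk_strictMono.tendsto_atTop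

lemma not_memL_geom : ¬ MemL (seqLaw geomLaw brk) := by
  intro h
  have h1 := ((h 1 one_pos).comp tendsto_brk).eventually_lt_const (show (1 : ℝ) < 2 by norm_num)
  obtain ⟨n, hn⟩ := h1.exists
  have h2 := le_tail_seqLaw (μ := geomLaw) brk_mono (x := brk n - 1) (k := n) (by linarith)
  simp only [Function.comp, tail_geom_brk] at hn
  rw [geomLaw_Ici] at h2
  rw [div_lt_iff₀ (by positivity), pow_succ, mul_inv] at hn
  linarith

lemma ofReal_tail {F : Measure ℝ} [IsFiniteMeasure F] (x : ℝ) :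
    ENNReal.ofReal (tail F x) = F (Ioi x) := ENNReal.ofReal_toReal (measure_ne_top _ _)

lemma not_memD_geom : ¬ MemD (seqLaw geomLaw brk) := by
  intro h
  obtain ⟨M, hM, hMtop⟩ := exists_between h
  have h1 := eventually_lt_of_limsup_lt hM
  lift M to NNReal using hMtop.ne
  obtain ⟨N, hN⟩ := exists_nat_gt (M : ℝ)
  have hseq : Tendsto (fun m => m ^ 2 + 2 * m) atTop atTop :=
    tendsto_atTop_mono (fun m => by simp only [id]; nlinarith) tendsto_id
  obtain ⟨m, hm, hNm⟩ := (((tendsto_brk.comp hseq).eventually h1).and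
    (eventually_ge_atTop N)).exists
  simp only [Function.comp] at hm
  have h2 : (brk (m ^ 2 + 2 * m) : ℝ) / 2 < brk (m ^ 2 + m) := by
    rw [brk_block le_rfl, brk_block (by omega)]
    push_cast
    have : (0 : ℝ) < 4 ^ (m + 1) ^ 2 := by positivity
    nlinarith
  have h3 := le_tail_seqLaw (μ := geomLaw) brk_mono h2
  rw [geomLaw_Ici] at h3
  rw [← ofReal_tail, ← ofReal_tail, tail_geom_brk, ← ENNReal.ofReal_div_of_pos (by positivity),
    ENNReal.ofReal_lt_coe_iff (div_nonneg (tail_pos isDistribution_geom _).le (by positivity)),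
    div_lt_iff₀ (by positivity)] at hm
  have h4 := h3.trans_lt hm
  rw [show m ^ 2 + 2 * m + 1 = m ^ 2 + m + (m + 1) by ring, pow_add _ _ (m + 1), mul_inv,
    mul_left_comm, ← div_eq_mul_inv (M : ℝ)] at h4
  have h7 := (lt_mul_iff_one_lt_right (by positivity)).1 h4
  rw [lt_div_iff₀ (by positivity), one_mul] at h7
  have h5 : (m + 1 : ℝ) < 2 ^ (m + 1) := by exact_mod_cast Nat.lt_two_pow_self (n := m + 1)
  have h6 : (N : ℝ) ≤ m := by exact_mod_cast hNm
  linarith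

lemma weakTailEquiv_geom_fine :
    WeakTailEquiv (seqLaw geomLaw brk) (seqLaw invUnifLaw fineBrk) := by
  have hratio : ∀ x, (seqLaw geomLaw brk) (Ioi x) / (seqLaw invUnifLaw fineBrk) (Ioi x) =
      ENNReal.ofReal (tail (seqLaw geomLaw brk) x / tail (seqLaw invUnifLaw fineBrk) x) := by
    intro x
    rw [ENNReal.ofReal_div_of_pos (tail_pos isDistribution_fine x), ofReal_tail, ofReal_tail]
  simp only [WeakTailEquiv, hratio]
  constructor
  · refine lt_of_lt_of_le (b := ENNReal.ofReal (1 / 2)) (by norm_num)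
      (le_liminf_of_le (by isBoundedDefault) ?_)
    filter_upwards [eventually_ge_atTop (brk 0 : ℝ)] with x hx
    refine ENNReal.ofReal_le_ofReal ?_
    rw [le_div_iff₀ (tail_pos isDistribution_fine x)]
    linarith [tail_fine_le hx]
  · refine lt_of_le_of_lt (limsup_le_of_le (a := 1) (by isBoundedDefault) ?_) ENNReal.one_lt_top
    refine Eventually.of_forall fun x => ?_
    rw [ENNReal.ofReal_le_one]
    exact div_le_one_of_le₀ (tail_geom_le_fine x) (tail_pos isDistribution_fine x).le

/-- there is a heavy-tailed `F ∈ 𝒥 \ (ℒ ∪ 𝒟)` with `F ∈ 𝒟𝒦₁` which is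
weakly tail equivalent to a subexponential distribution. -/
theorem exists_J_not_L_not_D_DK1_weakEquiv_subexp :
    ∃ F : Measure ℝ, IsDistribution F ∧ HeavyTailed F ∧ MemJ F ∧
      ¬ MemL F ∧ ¬ MemD F ∧ MemDK1 F ∧
      ∃ G : Measure ℝ, IsDistribution G ∧ MemS G ∧ WeakTailEquiv F G :=
  ⟨seqLaw geomLaw brk, isDistribution_geom, memDK1_geom.heavyTailed,
    negligibleDoubleJump_geom.memJ isDistribution_geom, not_memL_geom, not_memD_geom, memDK1_geom,
    seqLaw invUnifLaw fineBrk, isDistribution_fine,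
    negligibleDoubleJump_fine.memS isDistribution_fine memL_fine, weakTailEquiv_geom_fine⟩
end
end
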